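/- Let g be an isometry of (V, q), where q has signature (1, n−1), having a complex eigenvalue of modulus > 1; let λ and λ⁻¹ denote its unique eigenvalues of modulus > 1 and < 1 respectively (which are real). Then the eigenspaces E⁺ = ker(g − λ) and E⁻ = ker(g − λ⁻¹) are one-dimensional and are contained in the isotropic cone C₀ = {x ∈ V : q(x) = 0}; moreover, every g-invariant line ℝw ⊆ V with q(w) ≥ 0 is equal to E⁺ or to E⁻. -/

import Mathlib

/-- A quadratic form on a real vector space has signature `(1, n-1)` if it is equivalent to
the weighted sum of squares with one weight `+1` and `n-1` weights `-1`. -/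
def HasSignatureOneHyperbolic (n : ℕ) {V : Type*} [AddCommGroup V] [Module ℝ V]
    (q : QuadraticForm ℝ V) : Prop :=
  QuadraticMap.Equivalent q
    (QuadraticMap.weightedSumSquares ℝ (fun i : Fin n => if i.val = 0 then (1 : ℝ) else -1))

/-- A form of signature `(1, n-1)` is negative definite on the kernel of a linear functional. -/
lemma HasSignatureOneHyperbolic.exists_dual {n : ℕ} (hn : 0 < n) {V : Type*} [AddCommGroup V]
    [Module ℝ V] {q : QuadraticForm ℝ V} (hq : HasSignatureOneHyperbolic n q) :
    ∃ l : V →ₗ[ℝ] ℝ, ∀ z, l z = 0 → 0 ≤ q z → z = 0 := by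
  obtain ⟨e⟩ := hq
  refine ⟨LinearMap.proj (⟨0, hn⟩ : Fin n) ∘ₗ e.toLinearEquiv.toLinearMap, fun z hz hqz => ?_⟩
  have hz0 : e z ⟨0, hn⟩ = 0 := hz
  rw [← e.map_app, QuadraticMap.weightedSumSquares_apply] at hqz
  have hterm : ∀ i ∈ Finset.univ,
      (if (i : Fin n).val = 0 then (1 : ℝ) else -1) • (e z i * e z i) ≤ 0 := by
    intro i _
    split_ifs with hi
    · have : i = ⟨0, hn⟩ := Fin.ext hi
      simp [this, hz0]
    · simpa using mul_self_nonneg (e z i)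
  have hzero := (Finset.sum_eq_zero_iff_of_nonpos hterm).1
    (le_antisymm (Finset.sum_nonpos hterm) hqz)
  have hez : e.toLinearEquiv z = 0 := by
    funext i
    have hi := hzero i (Finset.mem_univ i)
    have hsq : e z i * e z i = 0 := by
      split_ifs at hi <;> simpa using hi
    exact mul_self_eq_zero.1 hsq
  exact e.toLinearEquiv.map_eq_zero_iff.1 hez

/-- Orthogonal vectors of the non-negative cone are proportional. -/
lemma HasSignatureOneHyperbolic.mem_span_of_polar_eq_zero {n : ℕ} (hn : 0 < n) {V : Type*}
    [AddCommGroup V] [Module ℝ V] {q : QuadraticForm ℝ V} (hq : HasSignatureOneHyperbolic n q)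
    {x y : V} (hx0 : x ≠ 0) (hx : 0 ≤ q x) (hy : 0 ≤ q y) (hxy : QuadraticMap.polar q x y = 0) :
    y ∈ Submodule.span ℝ {x} := by
  obtain ⟨l, hl⟩ := hq.exists_dual hn
  have hlx : l x ≠ 0 := fun h => hx0 (hl x h hx)
  have hz : l y • x + (-l x) • y = 0 := by
    refine hl _ (by simp [mul_comm]) ?_
    rw [QuadraticMap.map_add q, QuadraticMap.polar_smul_left, QuadraticMap.polar_smul_right, hxy,
      QuadraticMap.map_smul, QuadraticMap.map_smul]
    simp only [smul_eq_mul, mul_zero, add_zero]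
    exact add_nonneg (mul_nonneg (mul_self_nonneg _) hx) (mul_nonneg (mul_self_nonneg _) hy)
  refine Submodule.mem_span_singleton.2 ⟨(l x)⁻¹ * l y, ?_⟩
  rw [neg_smul, ← sub_eq_add_neg, sub_eq_zero] at hz
  rw [mul_smul, hz, inv_smul_smul₀ hlx]

/-- Eigenvectors of an isometry whose eigenvalues are not mutually inverse are orthogonal. -/
lemma QuadraticMap.polar_eq_zero_of_isometry {V : Type*} [AddCommGroup V] [Module ℝ V]
    {q : QuadraticForm ℝ V} {f : V →ₗ[ℝ] V} (hf : ∀ x, q (f x) = q x) {a b : ℝ} (hab : a * b ≠ 1)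
    {x y : V} (hx : f x = a • x) (hy : f y = b • y) : QuadraticMap.polar q x y = 0 := by
  have h : QuadraticMap.polar q (f x) (f y) = QuadraticMap.polar q x y := by
    simp only [QuadraticMap.polar, ← map_add, hf]
  rw [hx, hy, QuadraticMap.polar_smul_left, QuadraticMap.polar_smul_right, smul_eq_mul,
    smul_eq_mul, ← mul_assoc] at h
  by_contra h0
  exact hab ((mul_eq_right₀ h0).1 h)

/-- Eigenvectors of an isometry with eigenvalue different from `1` and `-1` are isotropic. -/
lemma QuadraticMap.eq_zero_of_isometry {V : Type*} [AddCommGroup V] [Module ℝ V]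
    {q : QuadraticForm ℝ V} {f : V →ₗ[ℝ] V} (hf : ∀ x, q (f x) = q x) {a : ℝ} (ha : a * a ≠ 1)
    {x : V} (hx : f x = a • x) : q x = 0 := by
  have h := hf x
  rw [hx, QuadraticMap.map_smul, smul_eq_mul] at h
  by_contra h0
  exact ha ((mul_eq_right₀ h0).1 h)

/-- An eigenspace of an isometry with eigenvalue different from `1` and `-1` is spanned by each
of its nonzero vectors. -/
lemma HasSignatureOneHyperbolic.span_eq_eigenspace {n : ℕ} (hn : 0 < n) {V : Type*}
    [AddCommGroup V] [Module ℝ V] {q : QuadraticForm ℝ V} (hq : HasSignatureOneHyperbolic n q)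
    {f : V →ₗ[ℝ] V} (hf : ∀ x, q (f x) = q x) {a : ℝ} (ha : a * a ≠ 1) {w : V} (hw0 : w ≠ 0)
    (hw : w ∈ Module.End.eigenspace f a) :
    Submodule.span ℝ {w} = Module.End.eigenspace f a := by
  refine le_antisymm ((Submodule.span_singleton_le_iff_mem _ _).2 hw) fun v hv => ?_
  rw [Module.End.mem_eigenspace_iff] at hw hv
  exact hq.mem_span_of_polar_eq_zero hn hw0 (QuadraticMap.eq_zero_of_isometry hf ha hw).ge
    (QuadraticMap.eq_zero_of_isometry hf ha hv).ge
    (QuadraticMap.polar_eq_zero_of_isometry hf ha hw hv)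

/-- Let `g` be a loxodromic isometry of `(V, q)`, `q` of signature `(1, n-1)`, with real
eigenvalues `lam` of modulus `> 1` and `lam⁻¹` of modulus `< 1`. Then the eigenspaces
`E⁺ = ker (g - lam)` and `E⁻ = ker (g - lam⁻¹)` are one-dimensional and contained in the
isotropic cone `{x | q x = 0}`, and every `g`-invariant line `ℝ w` with `q w ≥ 0` equals
`E⁺` or `E⁻`. -/
theorem loxodromic_eigenlines
    {n : ℕ} (hn : 2 ≤ n) {V : Type*} [AddCommGroup V] [Module ℝ V] [FiniteDimensional ℝ V]
    (hdim : Module.finrank ℝ V = n)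
    (q : QuadraticForm ℝ V) (hq : HasSignatureOneHyperbolic n q)
    (g : V ≃ₗ[ℝ] V) (hg : ∀ x : V, q (g x) = q x)
    (lam : ℝ) (hlam : 1 < |lam|)
    (hev : Module.End.HasEigenvalue (g : V →ₗ[ℝ] V) lam)
    (hev' : Module.End.HasEigenvalue (g : V →ₗ[ℝ] V) lam⁻¹) :
    Module.finrank ℝ (Module.End.eigenspace (g : V →ₗ[ℝ] V) lam) = 1 ∧
    Module.finrank ℝ (Module.End.eigenspace (g : V →ₗ[ℝ] V) lam⁻¹) = 1 ∧
    (∀ v ∈ Module.End.eigenspace (g : V →ₗ[ℝ] V) lam, q v = 0) ∧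
    (∀ v ∈ Module.End.eigenspace (g : V →ₗ[ℝ] V) lam⁻¹, q v = 0) ∧
    (∀ w : V, w ≠ 0 → 0 ≤ q w →
      Submodule.map (g : V →ₗ[ℝ] V) (Submodule.span ℝ {w}) = Submodule.span ℝ {w} →
      Submodule.span ℝ {w} = Module.End.eigenspace (g : V →ₗ[ℝ] V) lam ∨
      Submodule.span ℝ {w} = Module.End.eigenspace (g : V →ₗ[ℝ] V) lam⁻¹) := by
  have hn0 : 0 < n := by lia
  have hf : ∀ x, q ((g : V →ₗ[ℝ] V) x) = q x := hg
  have hlam0 : lam ≠ 0 := fun h => by simp [h] at hlam; linarith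
  have hsq : lam * lam ≠ 1 := by
    rw [← abs_mul_abs_self]
    nlinarith
  have hsq' : lam⁻¹ * lam⁻¹ ≠ 1 := by
    rwa [← mul_inv, ne_eq, inv_eq_one]
  obtain ⟨v, hv, hv0⟩ := hev.exists_hasEigenvector
  obtain ⟨v', hv', hv0'⟩ := hev'.exists_hasEigenvector
  have hqv {a : ℝ} (ha : a * a ≠ 1) (x : V)
      (hx : x ∈ Module.End.eigenspace (g : V →ₗ[ℝ] V) a) : q x = 0 :=
    QuadraticMap.eq_zero_of_isometry hf ha (Module.End.mem_eigenspace_iff.1 hx)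
  refine ⟨?_, ?_, hqv hsq, hqv hsq', fun w hw0 hqw hw => ?_⟩
  · rw [← hq.span_eq_eigenspace hn0 hf hsq hv0 hv, finrank_span_singleton hv0]
  · rw [← hq.span_eq_eigenspace hn0 hf hsq' hv0' hv', finrank_span_singleton hv0']
  · obtain ⟨a, ha⟩ : ∃ a : ℝ, a • w = (g : V →ₗ[ℝ] V) w := by
      rw [← Submodule.mem_span_singleton, ← hw]
      exact Submodule.mem_map_of_mem (Submodule.mem_span_singleton_self w)
    by_cases h : lam * a = 1
    · right
      refine hq.span_eq_eigenspace hn0 hf hsq' hw0 (Module.End.mem_eigenspace_iff.2 ?_)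
      rw [← ha, eq_inv_of_mul_eq_one_right h]
    · left
      refine hq.span_eq_eigenspace hn0 hf hsq hw0 ?_
      rw [← hq.span_eq_eigenspace hn0 hf hsq hv0 hv]
      exact hq.mem_span_of_polar_eq_zero hn0 hv0 (hqv hsq v hv).ge hqw
        (QuadraticMap.polar_eq_zero_of_isometry hf h (Module.End.mem_eigenspace_iff.1 hv) ha.symm)
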